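/- Let H be a complex Hilbert space and T a bounded linear operator on H such that m(T^n) > 0 for every n ≥ 1 and Σ_{n=1}^∞ (log max(‖T^n‖, m(T^n)^{-1})) / n² < ∞. Then there exist a complex Hilbert space K, an isometric linear embedding π : H → K, and an invertible bounded linear operator S on K such that S ∘ π = π ∘ T and Σ_{n ∈ ℤ} (log ‖S^n‖) / (1+n²) < ∞ (where for negative n, S^n denotes the |n|-th iterate of S^{-1}). -/

import Mathlib

universe u

/-- The minimum modulus `m(T) = inf {‖T x‖ : ‖x‖ = 1}` of a bounded operator. -/
noncomputable def minMod {X : Type*} [NormedAddCommGroup X] [NormedSpace ℂ X]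
    (T : X →L[ℂ] X) : ℝ :=
  sInf ((fun x : X => ‖T x‖) '' {x : X | ‖x‖ = 1})

section Scalar

open Finset

lemma antitone_mul_le_sum {e : ℕ → ℝ} (he : Antitone e) {p q m : ℕ} (h : p + q ≤ m + 1) :
    q * e m ≤ ∑ j ∈ range (p + q), e j - ∑ j ∈ range p, e j := by
  induction q with
  | zero => simp
  | succ q ih =>
    have h1 := ih (by omega)
    have h2 : e m ≤ e (p + q) := he (by omega)
    rw [← add_assoc, sum_range_succ]
    push_cast
    linarith

lemma sum_range_add_le_of_antitone {e : ℕ → ℝ} (he : Antitone e) (m n : ℕ) :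
    ∑ j ∈ range (m + n), e j ≤ ∑ j ∈ range m, e j + ∑ j ∈ range n, e j := by
  rw [sum_range_add]
  gcongr with j
  exact he (by omega)

lemma antitone_sum_range_div {e : ℕ → ℝ} (he : Antitone e) :
    Antitone fun n : ℕ => (∑ j ∈ range (n + 1), e j) / ((n : ℝ) + 1) := by
  refine antitone_nat_of_succ_le fun n => ?_
  have h := antitone_mul_le_sum he (p := 0) (q := n + 1) (m := n + 1) (by omega)
  rw [sum_range_succ _ (n + 1)]
  push_cast at h ⊢
  simp only [zero_add, range_zero, sum_empty, sub_zero] at h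
  rw [div_le_div_iff₀ (by positivity) (by positivity)]
  nlinarith

lemma summable_sum_range_div_sq {e : ℕ → ℝ} (h0 : ∀ n, 0 ≤ e n)
    (hs : Summable fun n : ℕ => e n / ((n : ℝ) + 1)) :
    Summable fun n : ℕ => (∑ j ∈ range (n + 1), e j) / ((n : ℝ) + 1) ^ 2 := by
  have key : ∀ N : ℕ, ∑ n ∈ range N, (∑ j ∈ range (n + 1), e j) / ((n : ℝ) + 1) ^ 2 ≤
      2 * ∑ n ∈ range N, e n / ((n : ℝ) + 1) - 2 * (∑ j ∈ range N, e j) / ((N : ℝ) + 1) := by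
    intro N
    induction N with
    | zero => simp
    | succ N ih =>
      rw [sum_range_succ, sum_range_succ (fun n : ℕ => e n / ((n : ℝ) + 1))]
      have hF : 0 ≤ ∑ j ∈ range (N + 1), e j := sum_nonneg fun j _ => h0 j
      have hN : ∑ j ∈ range N, e j = ∑ j ∈ range (N + 1), e j - e N := by
        rw [sum_range_succ]; ring
      rw [hN] at ih
      generalize ∑ j ∈ range (N + 1), e j = F at *
      have : F / ((N : ℝ) + 1) ^ 2 ≤ 2 * F / ((N : ℝ) + 1) - 2 * F / ((N : ℝ) + 1 + 1) := by
        rw [div_sub_div _ _ (by positivity) (by positivity),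
          div_le_div_iff₀ (by positivity) (by positivity)]
        have : 0 ≤ F * ((N : ℝ) + 1) ^ 2 * N := by positivity
        nlinarith
      have h2 : 2 * (F - e N) / ((N : ℝ) + 1) =
          2 * F / ((N : ℝ) + 1) - 2 * (e N / ((N : ℝ) + 1)) := by ring
      push_cast
      linarith
  refine summable_of_sum_range_le (c := 2 * ∑' n : ℕ, e n / ((n : ℝ) + 1))
    (fun n => div_nonneg (sum_nonneg fun j _ => h0 j) (by positivity)) fun N => (key N).trans ?_
  have h1 := hs.sum_le_tsum (range N) fun n _ => div_nonneg (h0 n) (by positivity)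
  have h2 : 0 ≤ 2 * (∑ j ∈ range N, e j) / ((N : ℝ) + 1) :=
    div_nonneg (mul_nonneg zero_le_two (sum_nonneg fun j _ => h0 j)) (by positivity)
  linarith

lemma exists_antitone_increments {a : ℕ → ℝ} (ha : Subadditive a) (h0 : ∀ n, 0 ≤ a n)
    (hz : a 0 = 0) (hs : Summable fun n : ℕ => a (n + 1) / ((n : ℝ) + 1) ^ 2) :
    ∃ e : ℕ → ℝ, Antitone e ∧ (∀ n, 0 ≤ e n) ∧ (∀ n, a n ≤ ∑ j ∈ range n, e j) ∧
      Summable fun n : ℕ => e n / ((n : ℝ) + 1) := by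
  set f : ℕ → ℝ := fun l => a (l + 1) / ((l : ℝ) + 1) with hf
  have hf0 : ∀ n, 0 ≤ f n := fun n => div_nonneg (h0 _) (by positivity)
  set e : ℕ → ℝ := fun n => (range (n + 1)).inf' nonempty_range_add_one f with he
  have hanti : Antitone e := fun m n hmn =>
    inf'_mono f (range_mono (by omega)) nonempty_range_add_one
  have he0 : ∀ n, 0 ≤ e n := fun n => le_inf' _ _ fun i _ => hf0 i
  refine ⟨e, hanti, he0, fun n => ?_, ?_⟩
  · induction n using Nat.strong_induction_on with
    | _ n ih =>
      rcases n with _ | n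
      · simp [hz]
      obtain ⟨l, hl, hel⟩ := exists_mem_eq_inf' (nonempty_range_add_one (n := n)) f
      rw [mem_range] at hl
      set q := (n + 1) / (l + 1)
      set r := (n + 1) % (l + 1)
      have hdiv : r + q * (l + 1) = n + 1 := Nat.mod_add_div' _ _
      have hr : r < l + 1 := Nat.mod_lt _ (by omega)
      have h1 := ha.apply_mul_add_le q (l + 1) r
      have h2 := ih r (by omega)
      have h3 := antitone_mul_le_sum hanti (p := r) (q := q * (l + 1)) (m := n) hdiv.le
      have h4 : e n * ((l : ℝ) + 1) = a (l + 1) := by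
        rw [show e n = f l from hel, hf]
        field_simp
      rw [hdiv] at h3
      rw [add_comm, hdiv, ← h4] at h1
      push_cast at h3
      linarith
  · refine hs.of_nonneg_of_le (fun n => div_nonneg (he0 n) (by positivity)) fun n => ?_
    have : e n ≤ f n := inf'_le _ (by simp)
    calc e n / ((n : ℝ) + 1) ≤ f n / ((n : ℝ) + 1) := by gcongr
      _ = _ := by rw [hf, div_div, ← sq]

/-- A nonnegative subadditive sequence with `∑ a n / n² < ∞` has a monotone subadditive majorant
with the same property that also controls its dyadic sums. -/
lemma exists_subadditive_dyadic_majorant {a : ℕ → ℝ} (ha : Subadditive a) (h0 : ∀ n, 0 ≤ a n)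
    (hz : a 0 = 0) (hs : Summable fun n : ℕ => a (n + 1) / ((n : ℝ) + 1) ^ 2) :
    ∃ G : ℕ → ℝ, Monotone G ∧ Subadditive G ∧ G 0 = 0 ∧ (∀ n, a n ≤ G n) ∧
      (∀ k, ∑ i ∈ range (k + 1), a (2 ^ i) ≤ 2 * G (2 ^ k)) ∧
      Summable fun n : ℕ => G (n + 1) / ((n : ℝ) + 1) ^ 2 := by
  obtain ⟨e, hanti, he0, hae, hes⟩ := exists_antitone_increments ha h0 hz hs
  set g : ℕ → ℝ := fun n => (∑ j ∈ range (n + 1), e j) / ((n : ℝ) + 1) with hg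
  have hganti : Antitone g := antitone_sum_range_div hanti
  have hg0 : ∀ n, 0 ≤ g n := fun n => div_nonneg (sum_nonneg fun j _ => he0 j) (by positivity)
  have hag : ∀ n, a (n + 1) ≤ ((n : ℝ) + 1) * g n := fun n => by
    rw [hg, mul_div_cancel₀ _ (by positivity)]
    exact hae _
  refine ⟨fun n => ∑ j ∈ range n, g j, ?_, ?_, by simp, ?_, ?_, ?_⟩
  · exact fun m n hmn => sum_le_sum_of_subset_of_nonneg (range_mono hmn) fun j _ _ => hg0 j
  · exact sum_range_add_le_of_antitone hganti
  · rintro (_ | n)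
    · simp [hz]
    · have := antitone_mul_le_sum hganti (p := 0) (q := n + 1) (m := n) (by omega)
      simp only [zero_add, range_zero, sum_empty, sub_zero] at this
      push_cast at this
      exact (hag n).trans this
  · intro k
    induction k with
    | zero =>
      have h1 := hag 0
      have h2 := hg0 0
      simp at h1 ⊢
      linarith
    | succ k ih =>
      rw [sum_range_succ]
      have hpos : 1 ≤ 2 ^ k := Nat.one_le_two_pow
      have h1 := antitone_mul_le_sum hganti (p := 2 ^ k) (q := 2 ^ k) (m := 2 ^ (k + 1) - 1)
        (by rw [pow_succ]; omega)
      have h2 := hag (2 ^ (k + 1) - 1)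
      rw [← mul_two, ← pow_succ] at h1
      rw [Nat.sub_add_cancel Nat.one_le_two_pow, Nat.cast_sub Nat.one_le_two_pow] at h2
      push_cast at h1 h2
      rw [pow_succ (2 : ℝ)] at h2
      linarith
  · refine summable_sum_range_div_sq hg0 ?_
    have := summable_sum_range_div_sq he0 hes
    refine this.congr fun n => ?_
    rw [hg, div_div, ← sq]

end Scalar

section MinMod

variable {X : Type*} [NormedAddCommGroup X] [NormedSpace ℂ X]

lemma minMod_mul_norm_le (A : X →L[ℂ] X) (x : X) : minMod A * ‖x‖ ≤ ‖A x‖ := by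
  rcases eq_or_ne x 0 with rfl | hx
  · simp
  have hx' : 0 < ‖x‖ := norm_pos_iff.2 hx
  have h : minMod A ≤ ‖A (((‖x‖⁻¹ : ℝ) : ℂ) • x)‖ := by
    refine csInf_le ⟨0, ?_⟩ ⟨_, ?_, rfl⟩
    · rintro _ ⟨y, -, rfl⟩
      exact norm_nonneg _
    · simp [norm_smul, hx'.ne']
  rw [map_smul, norm_smul, Complex.norm_real, norm_inv, norm_norm] at h
  calc minMod A * ‖x‖ ≤ ‖x‖⁻¹ * ‖A x‖ * ‖x‖ := by gcongr
    _ = ‖A x‖ := by field_simp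

lemma le_minMod [Nontrivial X] {A : X →L[ℂ] X} {c : ℝ} (h : ∀ x, c * ‖x‖ ≤ ‖A x‖) :
    c ≤ minMod A := by
  obtain ⟨x, hx⟩ := exists_norm_eq X zero_le_one
  refine le_csInf ⟨_, x, hx, rfl⟩ ?_
  rintro _ ⟨y, hy, rfl⟩
  simpa [show ‖y‖ = 1 from hy] using h y

lemma minMod_nonneg (A : X →L[ℂ] X) : 0 ≤ minMod A :=
  Real.sInf_nonneg (by rintro _ ⟨y, -, rfl⟩; exact norm_nonneg _)

lemma nontrivial_of_minMod_pos {A : X →L[ℂ] X} (h : 0 < minMod A) : Nontrivial X := by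
  by_contra hX
  rw [not_nontrivial_iff_subsingleton] at hX
  have : {x : X | ‖x‖ = 1} = ∅ := by
    ext x
    simp [Subsingleton.elim x 0]
  simp [minMod, this] at h

lemma minMod_le_norm [Nontrivial X] (A : X →L[ℂ] X) : minMod A ≤ ‖A‖ := by
  obtain ⟨x, hx⟩ := exists_norm_eq X zero_le_one
  have h1 := minMod_mul_norm_le A x
  have h2 := A.le_opNorm x
  rw [hx, mul_one] at h1 h2
  exact h1.trans h2

lemma minMod_one [Nontrivial X] : minMod (1 : X →L[ℂ] X) = 1 := by
  refine le_antisymm ?_ (le_minMod fun x => by simp)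
  simpa using minMod_le_norm (1 : X →L[ℂ] X)

lemma minMod_mul_le [Nontrivial X] (A B : X →L[ℂ] X) :
    minMod A * minMod B ≤ minMod (A * B) := by
  refine le_minMod fun x => ?_
  calc minMod A * minMod B * ‖x‖ = minMod A * (minMod B * ‖x‖) := mul_assoc _ _ _
    _ ≤ minMod A * ‖B x‖ :=
      mul_le_mul_of_nonneg_left (minMod_mul_norm_le B x) (minMod_nonneg A)
    _ ≤ ‖A (B x)‖ := minMod_mul_norm_le A _

/-- `log max(‖A‖, m(A)⁻¹)`. -/
noncomputable def logDistortion (A : X →L[ℂ] X) : ℝ :=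
  Real.log (max ‖A‖ (minMod A)⁻¹)

lemma one_le_max_norm_inv_minMod [Nontrivial X] {A : X →L[ℂ] X} (h : 0 < minMod A) :
    1 ≤ max ‖A‖ (minMod A)⁻¹ := by
  rcases le_total 1 (minMod A) with h1 | h1
  · exact le_max_of_le_left (h1.trans (minMod_le_norm A))
  · exact le_max_of_le_right (one_le_inv_iff₀.2 ⟨h, h1⟩)

lemma exp_logDistortion [Nontrivial X] {A : X →L[ℂ] X} (h : 0 < minMod A) :
    Real.exp (logDistortion A) = max ‖A‖ (minMod A)⁻¹ :=
  Real.exp_log (zero_lt_one.trans_le (one_le_max_norm_inv_minMod h))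

lemma logDistortion_nonneg [Nontrivial X] {A : X →L[ℂ] X} (h : 0 < minMod A) :
    0 ≤ logDistortion A :=
  Real.log_nonneg (one_le_max_norm_inv_minMod h)

lemma logDistortion_one [Nontrivial X] : logDistortion (1 : X →L[ℂ] X) = 0 := by
  simp [logDistortion, minMod_one]

lemma logDistortion_mul_le [Nontrivial X] {A B : X →L[ℂ] X} (hA : 0 < minMod A)
    (hB : 0 < minMod B) : logDistortion (A * B) ≤ logDistortion A + logDistortion B := by
  have hAB : 0 < minMod (A * B) := (mul_pos hA hB).trans_le (minMod_mul_le A B)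
  rw [← Real.exp_le_exp, Real.exp_add, exp_logDistortion hA, exp_logDistortion hB,
    exp_logDistortion hAB]
  refine max_le ((norm_mul_le A B).trans ?_) ?_
  · gcongr <;> exact le_max_left _ _
  · calc (minMod (A * B))⁻¹ ≤ (minMod A * minMod B)⁻¹ := by
          gcongr
          exact minMod_mul_le A B
      _ = (minMod A)⁻¹ * (minMod B)⁻¹ := mul_inv _ _
      _ ≤ _ := by gcongr <;> exact le_max_right _ _

end MinMod

open ContinuousLinearMap in
lemma exists_adjoint_apply_eq {H : Type*} [NormedAddCommGroup H] [InnerProductSpace ℂ H]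
    [CompleteSpace H] {A : H →L[ℂ] H} {c : ℝ} (hc : 0 < c) (h : ∀ x, c * ‖x‖ ≤ ‖A x‖) (y : H) :
    ∃ x, adjoint A x = y ∧ ‖x‖ ≤ c⁻¹ * ‖y‖ := by
  have hunit : IsUnit (adjoint A * A) := by
    refine isUnit_of_forall_le_norm_inner_map _ (c := ⟨c ^ 2, by positivity⟩)
      (show 0 < c ^ 2 by positivity) fun x => ?_
    rw [mul_apply_eq_comp, adjoint_inner_left, inner_self_eq_norm_sq_to_K]
    have : (c * ‖x‖) ^ 2 ≤ ‖A x‖ ^ 2 := by gcongr; exact h x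
    rw [mul_pow, mul_comm] at this
    simpa using! this
  obtain ⟨u, hu⟩ := ((isUnit_iff_bijective).1 hunit).2 y
  refine ⟨A u, hu, ?_⟩
  have h1 : ‖A u‖ ^ 2 ≤ ‖y‖ * ‖u‖ := by
    have h2 : inner ℂ y u = ((‖A u‖ : ℂ)) ^ 2 := by
      change adjoint A (A u) = y at hu
      rw [← hu, adjoint_inner_left, inner_self_eq_norm_sq_to_K]
      simp
    have h3 := norm_inner_le_norm (𝕜 := ℂ) y u
    rw [h2] at h3
    simpa using h3
  rw [inv_mul_eq_div, le_div_iff₀ hc]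
  have h2 := h u
  by_contra! hlt
  have hAu : 0 < ‖A u‖ := by
    by_contra! h0
    have := norm_nonneg y
    nlinarith [norm_nonneg (A u)]
  nlinarith [norm_nonneg u, norm_nonneg y]

section Orbit

variable {E : Type*} [NormedAddCommGroup E] [NormedSpace ℂ E]

open Finset

/-- An operator whose powers admit bounded right inverses has two-sided orbits through every point,
with growth controlled by the bounds along the powers of two. -/
lemma exists_two_sided_orbit {B : E →L[ℂ] E} {a G : ℕ → ℝ} (hB : ∀ n, ‖B ^ n‖ ≤ Real.exp (a n))
    (hsurj : ∀ n y, ∃ x, (B ^ n) x = y ∧ ‖x‖ ≤ Real.exp (a n) * ‖y‖)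
    (hG : Monotone G) (hG0 : 0 ≤ G 0) (haG : ∀ n, a n ≤ G n)
    (hdy : ∀ k, ∑ i ∈ range (k + 1), a (2 ^ i) ≤ 2 * G (2 ^ k)) (h : E) :
    ∃ y : ℤ → E, y 0 = h ∧ (∀ n, B (y (n + 1)) = y n) ∧
      ∀ n, ‖y n‖ ≤ Real.exp (3 * G n.natAbs) * ‖h‖ := by
  choose R hR hRn using hsurj
  let x : ℕ → E := fun k => Nat.rec h (fun k y => R (2 ^ k) y) k
  have hx : ∀ k, (B ^ 2 ^ k) (x (k + 1)) = x k := fun k => hR _ _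
  have hxn : ∀ k, ‖x k‖ ≤ Real.exp (∑ i ∈ range k, a (2 ^ i)) * ‖h‖ := by
    intro k
    induction k with
    | zero => simp [x]
    | succ k ih =>
      rw [sum_range_succ, Real.exp_add, mul_comm (Real.exp _), mul_assoc]
      exact (hRn _ _).trans (by gcongr)
  have hlt : ∀ n : ℕ, n < 2 ^ n := fun n => Nat.lt_two_pow_self
  let v : ℕ → E := fun n => (B ^ (2 ^ n - 1 - n)) (x n)
  have hstep : ∀ n k, n < 2 ^ k →
      (B ^ (2 ^ (k + 1) - 1 - n)) (x (k + 1)) = (B ^ (2 ^ k - 1 - n)) (x k) := by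
    intro n k hnk
    rw [← hx k, ← mul_apply_eq_comp, ← pow_add]
    congr 2
    rw [pow_succ]
    omega
  have hv : ∀ n k, n < 2 ^ k → v n = (B ^ (2 ^ k - 1 - n)) (x k) := by
    intro n k hnk
    have aux : ∀ m l, n < 2 ^ m →
        (B ^ (2 ^ (m + l) - 1 - n)) (x (m + l)) = (B ^ (2 ^ m - 1 - n)) (x m) := by
      intro m l hm
      induction l with
      | zero => rfl
      | succ l ih =>
        rw [← ih, ← add_assoc, hstep n (m + l)]
        exact hm.trans_le (Nat.pow_le_pow_right two_pos (by omega))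
    rw [← aux k n hnk, add_comm, aux n k (hlt n)]
  have hvB : ∀ n, B (v (n + 1)) = v n := by
    intro n
    have h1 := hlt (n + 1)
    rw [hv n (n + 1) (by omega), show 2 ^ (n + 1) - 1 - n = 2 ^ (n + 1) - 1 - (n + 1) + 1 by omega,
      pow_succ']
    rfl
  have hvn : ∀ n, ‖v n‖ ≤ Real.exp (3 * G n) * ‖h‖ := by
    intro n
    rcases Nat.eq_zero_or_pos n with rfl | hn
    · have : 1 ≤ Real.exp (3 * G 0) := Real.one_le_exp (by positivity)
      simpa [v, x] using le_mul_of_one_le_left (norm_nonneg h) this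
    set k := Nat.log 2 n
    have hk1 : 2 ^ k ≤ n := Nat.pow_log_le_self 2 hn.ne'
    have hk2 : n < 2 ^ (k + 1) := Nat.lt_pow_succ_log_self one_lt_two n
    rw [hv n _ hk2]
    refine (ContinuousLinearMap.le_opNorm _ _).trans ?_
    refine (mul_le_mul (hB (2 ^ (k + 1) - 1 - n)) (hxn (k + 1)) (norm_nonneg _)
      (Real.exp_pos _).le).trans ?_
    rw [← mul_assoc, ← Real.exp_add]
    gcongr
    have h1 := (haG (2 ^ (k + 1) - 1 - n)).trans (hG (show _ ≤ n by rw [pow_succ]; omega))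
    have h2 := hdy k
    have h3 := hG hk1
    linarith
  have hv0 : v 0 = h := rfl
  refine ⟨fun n => Int.casesOn n v fun m => (B ^ (m + 1)) h, hv0, ?_, ?_⟩
  · rintro (n | n)
    · exact hvB n
    · rcases n with _ | n
      · change B (v 0) = (B ^ 1) h
        rw [hv0, pow_one]
      · rw [show Int.negSucc (n + 1) + 1 = Int.negSucc n by lia]
        change B ((B ^ (n + 1)) h) = (B ^ (n + 1 + 1)) h
        rw [pow_succ' B (n + 1)]
        rfl
  · rintro (n | n)
    · exact hvn n
    · refine (ContinuousLinearMap.le_opNorm _ _).trans ?_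
      change ‖B ^ (n + 1)‖ * ‖h‖ ≤ Real.exp (3 * G (n + 1)) * ‖h‖
      gcongr
      refine (hB _).trans (Real.exp_le_exp.2 ?_)
      have h1 := haG (n + 1)
      have h2 := hG (Nat.zero_le (n + 1))
      linarith

end Orbit

section Dilation

open scoped ENNReal

variable {E : Type u} [NormedAddCommGroup E]

lemma memlp_two_of_norm_le_perm {ι : Type*} {z y : ι → E} (hz : Memℓp z 2) (σ : ι ≃ ι) {C : ℝ}
    (h : ∀ i, ‖y i‖ ≤ C * ‖z (σ i)‖) : Memℓp y 2 := by
  have h2 : 0 < (2 : ℝ≥0∞).toReal := by simp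
  rw [memℓp_gen_iff h2] at hz ⊢
  simp only [ENNReal.toReal_ofNat, Real.rpow_ofNat] at hz ⊢
  refine Summable.of_nonneg_of_le (fun i => sq_nonneg _) (fun i => ?_)
    ((σ.summable_iff.2 hz).mul_left (C ^ 2))
  rw [Function.comp_apply, ← mul_pow]
  gcongr
  exact h i

lemma lp_two_norm_le_of_perm {ι : Type*} (z y : lp (fun _ : ι => E) 2) (σ : ι ≃ ι) {C : ℝ}
    (hC : 0 ≤ C) (h : ∀ i, ‖y i‖ ≤ C * ‖z (σ i)‖) : ‖y‖ ≤ C * ‖z‖ := by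
  have h2 : 0 < (2 : ℝ≥0∞).toReal := by simp
  have hz := (lp.memℓp z).summable h2
  have hzn := lp.norm_rpow_eq_tsum h2 z
  refine lp.norm_le_of_tsum_le h2 (by positivity) ?_
  have hy := (lp.memℓp y).summable h2
  simp only [ENNReal.toReal_ofNat, Real.rpow_ofNat] at hz hzn hy ⊢
  rw [mul_pow, hzn, ← σ.tsum_eq fun i => ‖z i‖ ^ 2, ← tsum_mul_left]
  refine hy.tsum_le_tsum (fun i => ?_) ((σ.summable_iff.2 hz).mul_left (C ^ 2))
  rw [← mul_pow]
  gcongr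
  exact h i

variable [InnerProductSpace ℂ E]

/-- The sequences `z ∈ ℓ²(ℤ, E)` for which `n ↦ (w n)⁻¹ • z n` is a two-sided orbit of `B`, where
`B` maps the term of index `n + 1` to the term of index `n`. -/
def orbitSpace (B : E →L[ℂ] E) (w : ℤ → ℝ) : Submodule ℂ (lp (fun _ : ℤ => E) 2) where
  carrier := {z | ∀ n, B (((w (n + 1) : ℂ))⁻¹ • z (n + 1)) = ((w n : ℂ))⁻¹ • z n}
  add_mem' := by
    intro x y hx hy n
    simp only [lp.coeFn_add, Pi.add_apply, smul_add, map_add]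
    rw [hx n, hy n]
  zero_mem' := by intro n; simp
  smul_mem' := by
    intro c x hx n
    simp only [lp.coeFn_smul, Pi.smul_apply]
    rw [smul_comm, map_smul, hx n, smul_comm]

/-- Evaluation of a square-summable sequence at an index. -/
noncomputable def lpEval (n : ℤ) : lp (fun _ : ℤ => E) 2 →L[ℂ] E :=
  LinearMap.mkContinuous
    { toFun := fun z => z n
      map_add' := fun _ _ => rfl
      map_smul' := fun _ _ => rfl } 1
    (fun z => (lp.norm_apply_le_norm two_ne_zero z n).trans_eq (one_mul _).symm)

lemma isClosed_orbitSpace (B : E →L[ℂ] E) (w : ℤ → ℝ) :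
    IsClosed (orbitSpace B w : Set (lp (fun _ : ℤ => E) 2)) := by
  have : (orbitSpace B w : Set (lp (fun _ : ℤ => E) 2)) =
      ⋂ n, {z | B (((w (n + 1) : ℂ))⁻¹ • lpEval (n + 1) z) = ((w n : ℂ))⁻¹ • lpEval n z} := by
    ext z
    simp only [Set.mem_iInter]
    rfl
  rw [this]
  exact isClosed_iInter fun n => isClosed_eq (by fun_prop) (by fun_prop)

lemma exists_weighted_shift (B : E →L[ℂ] E) {w : ℤ → ℝ} (hw : ∀ n, 0 < w n) {C : ℝ} (k : ℤ)
    (hC : ∀ n, w n ≤ C * w (n - k)) :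
    ∃ L : orbitSpace B w →L[ℂ] orbitSpace B w, ‖L‖ ≤ C ∧
      ∀ z n, (L z).1 n = ((w n / w (n - k) : ℝ) : ℂ) • z.1 (n - k) := by
  have hC0 : 0 ≤ C := by
    by_contra! h
    nlinarith [hC 0, hw 0, hw (0 - k)]
  have hbd : ∀ (z : ℤ → E) n,
      ‖((w n / w (n - k) : ℝ) : ℂ) • z (n - k)‖ ≤ C * ‖z (Equiv.subRight k n)‖ := by
    intro z n
    rw [norm_smul, Complex.norm_real, Real.norm_of_nonneg (div_nonneg (hw _).le (hw _).le)]
    gcongr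
    · exact (div_le_iff₀ (hw _)).2 (hC n)
    · rfl
  let sh : lp (fun _ : ℤ => E) 2 → lp (fun _ : ℤ => E) 2 := fun z =>
    ⟨fun n => ((w n / w (n - k) : ℝ) : ℂ) • z (n - k),
      memlp_two_of_norm_le_perm (lp.memℓp z) (Equiv.subRight k) (hbd z)⟩
  have hsh : ∀ z ∈ orbitSpace B w, sh z ∈ orbitSpace B w := by
    intro z hz n
    have h := hz (n - k)
    have hcancel : ∀ m, ((w m : ℂ))⁻¹ * ((w m / w (m - k) : ℝ) : ℂ) = ((w (m - k) : ℂ))⁻¹ := by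
      intro m
      have := Complex.ofReal_ne_zero.2 (hw m).ne'
      push_cast
      field_simp
    change B (_ • (_ • z (n + 1 - k))) = _ • (_ • z (n - k))
    rw [smul_smul, smul_smul, hcancel, hcancel, show n + 1 - k = n - k + 1 by ring, h]
  refine ⟨LinearMap.mkContinuous
    { toFun := fun z => ⟨sh z.1, hsh z.1 z.2⟩
      map_add' := fun x y => ?_
      map_smul' := fun c x => ?_ } C ?_, LinearMap.mkContinuous_norm_le _ hC0 _, fun z n => rfl⟩
  · ext n
    exact smul_add _ _ _
  · ext n
    exact smul_comm _ _ _
  · intro z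
    exact lp_two_norm_le_of_perm z.1 (sh z.1) (Equiv.subRight k) hC0 (hbd z.1)

/-- An operator on a Hilbert space is a quotient of an invertible operator whose powers are bounded
by the growth of a weight along which two-sided orbits are square-summable. -/
lemma exists_invertible_lift [CompleteSpace E] (B : E →L[ℂ] E) {w C : ℤ → ℝ} (hw : ∀ n, 0 < w n)
    (hC : ∀ k n, w n ≤ C k * w (n - k))
    (horb : ∀ h, ∃ y : ℤ → E, y 0 = h ∧ (∀ n, B (y (n + 1)) = y n) ∧
      Summable fun n => (w n * ‖y n‖) ^ 2) :
    ∃ (N : Type u) (_ : NormedAddCommGroup N) (_ : InnerProductSpace ℂ N) (_ : CompleteSpace N)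
      (q : N →L[ℂ] E) (U : (N →L[ℂ] N)ˣ), Function.Surjective q ∧
        q ∘L (U : N →L[ℂ] N) = B ∘L q ∧ ∀ k : ℤ, ‖((U ^ k : (N →L[ℂ] N)ˣ) : N →L[ℂ] N)‖ ≤ C k := by
  choose L hLC hL using fun k => exists_weighted_shift B hw k (hC k)
  let φ : Multiplicative ℤ →* (orbitSpace B w →L[ℂ] orbitSpace B w) :=
    { toFun := fun k => L k.toAdd
      map_one' := by
        ext z n
        rw [hL]
        simp [(hw n).ne']
      map_mul' := fun k l => by
        ext z n
        rw [mul_apply_eq_comp, hL, hL, hL, smul_smul, toAdd_mul, sub_sub, ← Complex.ofReal_mul,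
          div_mul_div_cancel₀ (hw _).ne'] }
  have hφ : ∀ k : ℤ, φ.toHomUnits (Multiplicative.ofAdd 1) ^ k =
      φ.toHomUnits (Multiplicative.ofAdd k) := by
    intro k
    rw [← map_zpow, ← ofAdd_zsmul]
    simp
  refine ⟨orbitSpace B w, inferInstance, inferInstance,
    (isClosed_orbitSpace B w).completeSpace_coe,
    ((w 0 : ℂ))⁻¹ • (lpEval 0 ∘L (orbitSpace B w).subtypeL),
    φ.toHomUnits (Multiplicative.ofAdd 1), ?_, ?_, ?_⟩
  · intro h
    obtain ⟨y, hy0, hyB, hys⟩ := horb h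
    have hcancel : ∀ n, ((w n : ℂ))⁻¹ • ((w n : ℂ) • y n) = y n := fun n =>
      inv_smul_smul₀ (Complex.ofReal_ne_zero.2 (hw n).ne') _
    have hmem : Memℓp (fun n => (w n : ℂ) • y n) 2 := by
      rw [memℓp_gen_iff (by simp)]
      refine hys.congr fun n => ?_
      rw [norm_smul, Complex.norm_real, Real.norm_of_nonneg (hw n).le]
      simp
    refine ⟨⟨⟨_, hmem⟩, fun n => ?_⟩, ?_⟩
    · change B (((w (n + 1) : ℂ))⁻¹ • ((w (n + 1) : ℂ) • y (n + 1))) =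
        ((w n : ℂ))⁻¹ • ((w n : ℂ) • y n)
      rw [hcancel, hcancel, hyB]
    · change ((w 0 : ℂ))⁻¹ • ((w 0 : ℂ) • y 0) = h
      rw [hcancel, hy0]
  · ext z
    change ((w 0 : ℂ))⁻¹ • (L 1 z).1 0 = B (((w 0 : ℂ))⁻¹ • z.1 0)
    have h := z.2 (-1)
    rw [neg_add_cancel] at h
    rw [h, hL, smul_smul, zero_sub]
    congr 1
    have := Complex.ofReal_ne_zero.2 (hw 0).ne'
    push_cast
    field_simp
  · intro k
    rw [hφ]
    exact hLC k

open ContinuousLinearMap in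
lemma adjoint_bounded_below_of_surjective {N : Type*} [NormedAddCommGroup N]
    [InnerProductSpace ℂ N] [CompleteSpace N] [CompleteSpace E] {q : N →L[ℂ] E}
    (hq : Function.Surjective q) : ∃ K, AntilipschitzWith K (adjoint q) := by
  obtain ⟨C, hC, h⟩ := q.exists_preimage_norm_le hq
  refine ⟨⟨C, hC.le⟩, AddMonoidHomClass.antilipschitz_of_bound _ fun x => ?_⟩
  obtain ⟨y, hy, hyn⟩ := h x
  have h1 : ‖x‖ ^ 2 ≤ ‖adjoint q x‖ * ‖y‖ := by
    have h2 := norm_inner_le_norm (𝕜 := ℂ) (adjoint q x) y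
    rw [adjoint_inner_left, hy, inner_self_eq_norm_sq_to_K] at h2
    simpa using h2
  have h3 : ‖adjoint q x‖ * ‖y‖ ≤ ‖adjoint q x‖ * (C * ‖x‖) := by gcongr
  rcases (norm_nonneg x).eq_or_lt with h0 | h0
  · rw [← h0]
    positivity
  · change ‖x‖ ≤ C * ‖adjoint q x‖
    refine le_of_mul_le_mul_right ?_ h0
    linarith

/-- An embedding of Hilbert spaces becomes isometric after an equivalent Hilbertian renorming of the
target. -/
lemma exists_equiv_comp_isometric {N : Type u} [NormedAddCommGroup N] [InnerProductSpace ℂ N]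
    [CompleteSpace N] [CompleteSpace E] (j : E →L[ℂ] N) (hj : ∃ K, AntilipschitzWith K j) :
    ∃ (K : Type u) (_ : NormedAddCommGroup K) (_ : InnerProductSpace ℂ K) (_ : CompleteSpace K)
      (Φ : N ≃L[ℂ] K), ∀ x, ‖Φ (j x)‖ = ‖x‖ := by
  obtain ⟨c, hc⟩ := hj
  have hinj : Function.Injective j := hc.injective
  have hcl : IsClosed (j.range : Set N) := by
    rw [LinearMap.coe_range]
    exact hc.isClosed_range j.uniformContinuous
  have : CompleteSpace j.range := hcl.completeSpace_coe
  have hcompl := Submodule.isCompl_orthogonal (K := j.range)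
  let Ψ : (E × j.rangeᗮ) →L[ℂ] N := j.coprod j.rangeᗮ.subtypeL
  have hker : Ψ.ker = ⊥ := by
    refine LinearMap.ker_eq_bot'.2 fun p hp => ?_
    have hp' : j p.1 + (p.2 : N) = 0 := hp
    have h2 : (p.2 : N) ∈ j.range ⊓ j.rangeᗮ :=
      ⟨by
        rw [eq_neg_of_add_eq_zero_right hp', ← map_neg]
        exact ⟨_, rfl⟩, p.2.2⟩
    rw [hcompl.inf_eq_bot, Submodule.mem_bot] at h2
    rw [h2, add_zero] at hp'
    exact Prod.ext (hinj (by simpa using hp')) (Subtype.ext h2)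
  have hrange : Ψ.range = ⊤ := by
    refine LinearMap.range_eq_top.2 fun y => ?_
    have hy : y ∈ j.range ⊔ j.rangeᗮ := by rw [hcompl.sup_eq_top]; trivial
    obtain ⟨_, ⟨x, rfl⟩, v, hv, rfl⟩ := Submodule.mem_sup.1 hy
    exact ⟨(x, ⟨v, hv⟩), rfl⟩
  let Θ := ContinuousLinearEquiv.ofBijective Ψ hker hrange
  refine ⟨WithLp 2 (E × j.rangeᗮ), inferInstance, inferInstance, inferInstance,
    Θ.symm.trans (WithLp.prodContinuousLinearEquiv 2 ℂ E j.rangeᗮ).symm, fun x => ?_⟩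
  have h : Θ.symm (j x) = (x, 0) := by
    rw [ContinuousLinearEquiv.symm_apply_eq]
    change j x = j x + ((0 : j.rangeᗮ) : N)
    simp
  rw [ContinuousLinearEquiv.trans_apply, h]
  exact WithLp.norm_toLp_fst 2 E j.rangeᗮ x

open ContinuousLinearMap in
/-- Dual form of `exists_invertible_lift`: an invertible isometric extension with controlled
powers. -/
lemma exists_invertible_extension [CompleteSpace E] (T : E →L[ℂ] E) {w C : ℤ → ℝ}
    (hw : ∀ n, 0 < w n) (hC : ∀ k n, w n ≤ C k * w (n - k))
    (horb : ∀ h, ∃ y : ℤ → E, y 0 = h ∧ (∀ n, adjoint T (y (n + 1)) = y n) ∧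
      Summable fun n => (w n * ‖y n‖) ^ 2) :
    ∃ (K : Type u) (_ : NormedAddCommGroup K) (_ : InnerProductSpace ℂ K) (_ : CompleteSpace K)
      (π : E →L[ℂ] K) (S : K ≃L[ℂ] K) (M : ℝ), 0 < M ∧ (∀ x, ‖π x‖ = ‖x‖) ∧
        (∀ x, S (π x) = π (T x)) ∧
        ∀ k : ℤ, ‖((S ^ k : K ≃L[ℂ] K) : K →L[ℂ] K)‖ ≤ M * C k := by
  obtain ⟨N, _, _, _, q, U, hq, hqU, hU⟩ := exists_invertible_lift (adjoint T) hw hC horb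
  obtain ⟨K, _, _, _, Φ, hΦ⟩ :=
    exists_equiv_comp_isometric (adjoint q) (adjoint_bounded_below_of_surjective hq)
  let V : N ≃L[ℂ] N := ContinuousLinearEquiv.unitsEquiv ℂ N (star U)
  have hV : ∀ x, V (adjoint q x) = adjoint q (T x) := by
    intro x
    have h := congrArg adjoint hqU
    rw [adjoint_comp, adjoint_comp, adjoint_adjoint] at h
    exact DFunLike.congr_fun h x
  have hVk : ∀ k : ℤ, ‖((V ^ k : N ≃L[ℂ] N) : N →L[ℂ] N)‖ ≤ C k := by
    intro k
    have h : ((V ^ k : N ≃L[ℂ] N) : N →L[ℂ] N) = star ((U ^ k : (N →L[ℂ] N)ˣ) : N →L[ℂ] N) := by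
      rw [← Units.coe_star, star_zpow, ← map_zpow]
      rfl
    rw [h, norm_star]
    exact hU k
  have hconj : ∀ k : ℤ, ((Φ.symm.trans V).trans Φ) ^ k = (Φ.symm.trans (V ^ k)).trans Φ := by
    let c : (N ≃L[ℂ] N) →* (K ≃L[ℂ] K) :=
      { toFun := fun W => (Φ.symm.trans W).trans Φ
        map_one' := by
          ext x
          exact Φ.apply_symm_apply x
        map_mul' := fun W W' => by
          ext x
          exact congrArg (fun y => Φ (W y)) (Φ.symm_apply_apply (W' (Φ.symm x))).symm }
    exact fun k => (map_zpow c V k).symm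
  refine ⟨K, inferInstance, inferInstance, inferInstance, (Φ : N →L[ℂ] K) ∘L adjoint q,
    (Φ.symm.trans V).trans Φ, ‖(Φ : N →L[ℂ] K)‖ * ‖(Φ.symm : K →L[ℂ] N)‖ + 1, by positivity, hΦ,
    fun x => ?_, fun k => ?_⟩
  · change Φ (V (Φ.symm (Φ (adjoint q x)))) = Φ (adjoint q (T x))
    rw [Φ.symm_apply_apply, hV]
  · rw [hconj]
    have hCk : 0 ≤ C k := (norm_nonneg _).trans (hVk k)
    calc _ = ‖(Φ : N →L[ℂ] K) ∘L ((V ^ k : N ≃L[ℂ] N) : N →L[ℂ] N) ∘L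
            (Φ.symm : K →L[ℂ] N)‖ := rfl
      _ ≤ ‖(Φ : N →L[ℂ] K)‖ * (‖((V ^ k : N ≃L[ℂ] N) : N →L[ℂ] N)‖ *
            ‖(Φ.symm : K →L[ℂ] N)‖) :=
          (opNorm_comp_le _ _).trans (by gcongr; exact opNorm_comp_le _ _)
      _ ≤ ‖(Φ : N →L[ℂ] K)‖ * (C k * ‖(Φ.symm : K →L[ℂ] N)‖) := by
          gcongr
          exact hVk k
      _ ≤ _ := by nlinarith

end Dilation

section Weight

/-- The weight `e^{3 G(|n|)} (1 + |n|)` attached to a growth function `G`. -/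
noncomputable def growthWeight (G : ℕ → ℝ) (n : ℤ) : ℝ :=
  Real.exp (3 * G n.natAbs) * (1 + n.natAbs)

lemma growthWeight_pos (G : ℕ → ℝ) (n : ℤ) : 0 < growthWeight G n := by
  unfold growthWeight
  positivity

lemma inv_growthWeight_le {G : ℕ → ℝ} (hG : Monotone G) (hsub : Subadditive G) (k n : ℤ) :
    (growthWeight G n)⁻¹ ≤ growthWeight G k * (growthWeight G (n - k))⁻¹ := by
  rw [← div_eq_mul_inv, le_div_iff₀ (growthWeight_pos _ _),
    inv_mul_le_iff₀ (growthWeight_pos _ _)]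
  have habs : (n - k).natAbs ≤ n.natAbs + k.natAbs := Int.natAbs_sub_le n k
  have habs' : ((n - k).natAbs : ℝ) ≤ n.natAbs + k.natAbs := by exact_mod_cast habs
  have h1 : G (n - k).natAbs ≤ G n.natAbs + G k.natAbs := (hG habs).trans (hsub _ _)
  unfold growthWeight
  calc Real.exp (3 * G (n - k).natAbs) * (1 + (n - k).natAbs)
      ≤ Real.exp (3 * G n.natAbs + 3 * G k.natAbs) * ((1 + n.natAbs) * (1 + k.natAbs)) := by
        gcongr
        · linarith
        · have : (0 : ℝ) ≤ n.natAbs * k.natAbs := by positivity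
          linarith
    _ = _ := by rw [Real.exp_add]; ring

lemma summable_inv_one_add_natAbs_sq : Summable fun n : ℤ => ((1 + (n.natAbs : ℝ)) ^ 2)⁻¹ := by
  have h : Summable fun n : ℕ => ((1 + (n : ℝ)) ^ 2)⁻¹ := by
    refine ((summable_nat_add_iff 1).2 (Real.summable_nat_pow_inv.2 one_lt_two)).congr fun n => ?_
    push_cast
    rw [add_comm]
  exact .of_nat_of_neg (by simpa using h) (by simpa using h)

lemma summable_log_div_sq : Summable fun n : ℕ => Real.log ((n : ℝ) + 2) / ((n : ℝ) + 1) ^ 2 := by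
  have hs : Summable fun n : ℕ => ((n : ℝ) + 1)⁻¹ / ((n : ℝ) + 1) := by
    refine ((summable_nat_add_iff 1).2 (Real.summable_nat_pow_inv.2 one_lt_two)).congr fun n => ?_
    push_cast
    field_simp
  refine (summable_sum_range_div_sq (fun n => by positivity) hs).of_nonneg_of_le
    (fun n => div_nonneg (Real.log_nonneg (by linarith [n.cast_nonneg (α := ℝ)])) (by positivity))
    fun n => ?_
  gcongr
  have := log_add_one_le_harmonic (n + 1)
  simp only [harmonic] at this
  push_cast at this
  rwa [show (n : ℝ) + 2 = n + 1 + 1 by ring]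

lemma summable_log_growthWeight {G : ℕ → ℝ} (hG0 : ∀ n, 0 ≤ G n)
    (hs : Summable fun n : ℕ => G (n + 1) / ((n : ℝ) + 1) ^ 2) {c : ℝ} (hc : 0 ≤ c) :
    Summable fun n : ℤ => (c + Real.log (growthWeight G n)) / (1 + (n : ℝ) ^ 2) := by
  have h : Summable fun n : ℕ => (c + Real.log (growthWeight G n)) / (1 + (n : ℝ) ^ 2) := by
    rw [← summable_nat_add_iff 1]
    have h1 := (summable_nat_add_iff 1).2 (Real.summable_nat_pow_inv.2 one_lt_two)
    refine (((h1.mul_left c).add (hs.mul_left 3)).add summable_log_div_sq).of_nonneg_of_le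
      (fun n => ?_) fun n => ?_
    all_goals
      have hlog : Real.log (growthWeight G ((n + 1 : ℕ) : ℤ)) =
          3 * G (n + 1) + Real.log ((n : ℝ) + 2) := by
        rw [growthWeight, Int.natAbs_natCast, Real.log_mul (Real.exp_pos _).ne' (by positivity),
          Real.log_exp]
        push_cast
        ring_nf
      have hl : 0 ≤ Real.log ((n : ℝ) + 2) :=
        Real.log_nonneg (by linarith [n.cast_nonneg (α := ℝ)])
      have hg := hG0 (n + 1)
      rw [hlog]
    · positivity
    · calc _ ≤ (c + (3 * G (n + 1) + Real.log ((n : ℝ) + 2))) / ((n : ℝ) + 1) ^ 2 := by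
            push_cast
            gcongr
            linarith
        _ = _ := by push_cast; ring
  refine .of_nat_of_neg (by simpa using h) ?_
  simpa [growthWeight] using h

end Weight

lemma abs_log_norm_zpow_le {K : Type*} [NormedAddCommGroup K] [NormedSpace ℂ K] (S : K ≃L[ℂ] K)
    {D : ℤ → ℝ} (hD : ∀ k : ℤ, ‖((S ^ k : K ≃L[ℂ] K) : K →L[ℂ] K)‖ ≤ D k) (hD1 : ∀ k, 1 ≤ D k)
    (hneg : ∀ k, D (-k) = D k) (n : ℤ) :
    |Real.log ‖((S ^ n : K ≃L[ℂ] K) : K →L[ℂ] K)‖| ≤ Real.log (D n) := by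
  rcases subsingleton_or_nontrivial K with hK | hK
  · have h0 : ((S ^ n : K ≃L[ℂ] K) : K →L[ℂ] K) = 0 := by
      ext x
      exact Subsingleton.elim _ _
    rw [h0, norm_zero, Real.log_zero, abs_zero]
    exact Real.log_nonneg (hD1 n)
  have hone : 1 ≤ ‖((S ^ n : K ≃L[ℂ] K) : K →L[ℂ] K)‖ *
      ‖((S ^ (-n) : K ≃L[ℂ] K) : K →L[ℂ] K)‖ := by
    have h : ((S ^ n : K ≃L[ℂ] K) : K →L[ℂ] K) * ((S ^ (-n) : K ≃L[ℂ] K) : K →L[ℂ] K) = 1 := by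
      have h' : S ^ n * S ^ (-n) = 1 := by rw [← zpow_add, add_neg_cancel, zpow_zero]
      exact congrArg (fun W : K ≃L[ℂ] K => (W : K →L[ℂ] K)) h'
    calc (1 : ℝ) = ‖(1 : K →L[ℂ] K)‖ := norm_one.symm
      _ ≤ _ := h ▸ norm_mul_le _ _
  have hpos : 0 < ‖((S ^ n : K ≃L[ℂ] K) : K →L[ℂ] K)‖ := by
    refine (norm_nonneg _).lt_of_ne fun h => ?_
    rw [← h, zero_mul] at hone
    exact absurd hone (by norm_num)
  refine abs_le.2 ⟨?_, Real.log_le_log hpos (hD n)⟩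
  rw [← Real.log_inv]
  refine Real.log_le_log (inv_pos.2 (zero_lt_one.trans_le (hD1 n))) ?_
  rw [inv_le_iff_one_le_mul₀ (zero_lt_one.trans_le (hD1 n))]
  have h := hD (-n)
  rw [hneg] at h
  exact hone.trans (by gcongr)

/-- Theorem 4.5, Hilbert-space case: a Hilbert-space operator
satisfying the Beurling-type condition `∑ log max(‖Tⁿ‖, m(Tⁿ)⁻¹)/n² < ∞` has an
invertible extension `S` on a Hilbert space with `∑_{n ∈ ℤ} log ‖Sⁿ‖/(1+n²) < ∞`. -/
theorem beurling_extension_hilbert {H : Type u} [NormedAddCommGroup H]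
    [InnerProductSpace ℂ H] [CompleteSpace H] (T : H →L[ℂ] H)
    (hm : ∀ n : ℕ, 1 ≤ n → 0 < minMod (T ^ n))
    (hB : Summable fun n : ℕ =>
      Real.log (max ‖T ^ (n + 1)‖ (minMod (T ^ (n + 1)))⁻¹) / ((n : ℝ) + 1) ^ 2) :
    ∃ (K : Type u) (_ : NormedAddCommGroup K) (_ : InnerProductSpace ℂ K)
      (_ : CompleteSpace K) (π : H →L[ℂ] K) (S : K ≃L[ℂ] K),
        (∀ x : H, ‖π x‖ = ‖x‖) ∧
        (∀ x : H, S (π x) = π (T x)) ∧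
        (Summable fun n : ℤ =>
          Real.log ‖((S ^ n : K ≃L[ℂ] K) : K →L[ℂ] K)‖ / (1 + (n : ℝ) ^ 2)) := by
  have : Nontrivial H := nontrivial_of_minMod_pos (hm 1 le_rfl)
  have hm' : ∀ n, 0 < minMod (T ^ n) := by
    rintro (_ | n)
    · rw [pow_zero, minMod_one]
      exact one_pos
    · exact hm _ (by omega)
  obtain ⟨G, hG, hsub, hG0, haG, hdy, hs⟩ :=
    exists_subadditive_dyadic_majorant (a := fun n => logDistortion (T ^ n))
      (fun m n => by
        beta_reduce
        rw [pow_add]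
        exact logDistortion_mul_le (hm' m) (hm' n))
      (fun n => logDistortion_nonneg (hm' n)) (by simp [logDistortion_one]) hB
  have hGn : ∀ n, 0 ≤ G n := fun n => hG0 ▸ hG n.zero_le
  have hstar : ∀ n, ContinuousLinearMap.adjoint T ^ n = ContinuousLinearMap.adjoint (T ^ n) :=
    fun n => (star_pow T n).symm
  obtain ⟨K, _, _, _, π, S, M, hM, hπ, hSπ, hS⟩ :=
    exists_invertible_extension T (w := fun n => (growthWeight G n)⁻¹) (C := growthWeight G)
      (fun n => inv_pos.2 (growthWeight_pos G n)) (inv_growthWeight_le hG hsub) fun h => by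
        obtain ⟨y, hy0, hyB, hyn⟩ := exists_two_sided_orbit
          (B := ContinuousLinearMap.adjoint T) (a := fun n => logDistortion (T ^ n)) (G := G)
          (fun n => by
            rw [hstar, LinearIsometryEquiv.norm_map, exp_logDistortion (hm' n)]
            exact le_max_left _ _)
          (fun n y => by
            obtain ⟨x, hx, hxn⟩ := exists_adjoint_apply_eq (hm' n) (minMod_mul_norm_le (T ^ n)) y
            refine ⟨x, by rw [hstar, hx], hxn.trans ?_⟩
            rw [exp_logDistortion (hm' n)]
            gcongr
            exact le_max_right _ _)
          hG hG0.ge haG hdy h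
        refine ⟨y, hy0, hyB, (summable_inv_one_add_natAbs_sq.mul_left (‖h‖ ^ 2)).of_nonneg_of_le
          (fun n => sq_nonneg _) fun n => ?_⟩
        calc ((growthWeight G n)⁻¹ * ‖y n‖) ^ 2
            ≤ ((growthWeight G n)⁻¹ * (Real.exp (3 * G n.natAbs) * ‖h‖)) ^ 2 := by
              have := growthWeight_pos G n
              gcongr
              exact hyn n
          _ = ‖h‖ ^ 2 * ((1 + (n.natAbs : ℝ)) ^ 2)⁻¹ := by
              rw [growthWeight]
              field_simp
  refine ⟨K, inferInstance, inferInstance, inferInstance, π, S, hπ, hSπ, ?_⟩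
  have hW1 : ∀ k, 1 ≤ growthWeight G k := fun k =>
    one_le_mul_of_one_le_of_one_le (Real.one_le_exp (by linarith [hGn k.natAbs])) (by simp)
  have hlog := abs_log_norm_zpow_le S (D := fun k => max M 1 * growthWeight G k)
    (fun k => (hS k).trans (mul_le_mul_of_nonneg_right (le_max_left _ _) (growthWeight_pos G k).le))
    (fun k => one_le_mul_of_one_le_of_one_le (le_max_right _ _) (hW1 k))
    (fun k => by simp [growthWeight])
  refine .of_norm_bounded
    (summable_log_growthWeight hGn hs (Real.log_nonneg (le_max_right M 1))) fun n => ?_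
  rw [Real.norm_eq_abs, abs_div, abs_of_pos (by positivity : (0 : ℝ) < 1 + (n : ℝ) ^ 2)]
  gcongr
  refine (hlog n).trans_eq (Real.log_mul ?_ (growthWeight_pos G n).ne')
  positivity
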